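/- Let g, h ∈ G(Γ) and v ∈ Γ, and suppose h does not end with G(lk(v)). (a) If h⁻¹ begins with G_v but h⁻¹g does not begin with G_v, then there is a reduced word g ≡ g₁⋯g_n such that h ≡ g₁⋯g_m and g_m ∈ G_v for some m ≤ n. (b) If h⁻¹g begins with G_v but h⁻¹ does not begin with G_v, then there is a reduced word g ≡ g₁⋯g_n such that h ≡ g₁⋯g_m and g_{m+1} ∈ G_v for some m < n. -/

import Mathlib

open scoped ComplexOrder commutatorElement

/-! ## Operator-norm notions -/

/-- `φ` is completely bounded (as a Herz–Schur multiplier) with cb-norm at most `C`: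
there are a Hilbert space `H` and bounded maps `α β : G → H` with
`φ (h⁻¹ * g) = ⟪α g, β h⟫` and `(sup ‖α‖) * (sup ‖β‖) ≤ C`. -/
def HasCBNormBound {G : Type} [Group G] (φ : G → ℂ) (C : ℝ) : Prop :=
  ∃ (H : Type) (_ : NormedAddCommGroup H) (_ : InnerProductSpace ℂ H)
    (α β : G → H) (Ca Cb : ℝ),
      (∀ g, ‖α g‖ ≤ Ca) ∧ (∀ h, ‖β h‖ ≤ Cb) ∧ Ca * Cb ≤ C ∧
      ∀ g h : G, φ (h⁻¹ * g) = (inner ℂ (α g) (β h) : ℂ)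

/-- A kernel `φ : G × G → ℂ` is completely bounded with cb-norm at most `C`. -/
def HasCBKernelBound {G : Type} (φ : G → G → ℂ) (C : ℝ) : Prop :=
  ∃ (H : Type) (_ : NormedAddCommGroup H) (_ : InnerProductSpace ℂ H)
    (α β : G → H) (Ca Cb : ℝ),
      (∀ g, ‖α g‖ ≤ Ca) ∧ (∀ h, ‖β h‖ ≤ Cb) ∧ Ca * Cb ≤ C ∧
      ∀ g h : G, φ g h = (inner ℂ (α g) (β h) : ℂ)

/-- A function `φ : G → ℂ` is positive definite. -/
def IsPosDefFn {G : Type} [Group G] (φ : G → ℂ) : Prop :=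
  ∀ (n : ℕ) (c : Fin n → ℂ) (x : Fin n → G),
    0 ≤ ∑ i, ∑ j, c i * (starRingEnd ℂ) (c j) * φ ((x j)⁻¹ * x i)

/-- A kernel `Ψ : G × G → ℂ` is positive definite. -/
def IsPosDefKernel {X : Type} (Ψ : X → X → ℂ) : Prop :=
  ∀ (n : ℕ) (c : Fin n → ℂ) (x : Fin n → X),
    0 ≤ ∑ i, ∑ j, c i * (starRingEnd ℂ) (c j) * Ψ (x i) (x j)

/-- A (discrete) group is amenable iff it admits an approximate identity of finitely
supported positive definite functions; we use this characterization. -/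
def AmenablePD (G : Type) [Group G] : Prop :=
  ∀ (S : Finset G) (ε : ℝ), 0 < ε →
    ∃ φ : G → ℂ, (Function.support φ).Finite ∧ IsPosDefFn φ ∧ ∀ g ∈ S, ‖φ g - 1‖ < ε

/-- A group is weakly amenable with Cowling–Haagerup constant 1: there is a net of finitely
supported completely bounded functions converging to 1 pointwise with cb-norms with
limsup at most 1. -/
def WeaklyAmenableCH1 (G : Type) [Group G] : Prop :=
  ∀ (S : Finset G) (ε : ℝ), 0 < ε →
    ∃ φ : G → ℂ, (Function.support φ).Finite ∧ HasCBNormBound φ (1 + ε) ∧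
      ∀ g ∈ S, ‖φ g - 1‖ < ε

/-! ## Graph products -/

section GraphProd

variable {V : Type} (Γ : SimpleGraph V) (G : V → Type) [∀ v, Group (G v)]

/-- The commutators `[G_v, G_w]` over the edges of `Γ`. -/
def commRels : Set (Monoid.CoprodI G) :=
  {x | ∃ (v w : V) (a : G v) (b : G w), Γ.Adj v w ∧
    x = ⁅Monoid.CoprodI.of a, Monoid.CoprodI.of b⁆}

/-- The graph product of the groups `G v` over the graph `Γ`. -/
abbrev GraphProduct :=
  Monoid.CoprodI G ⧸ Subgroup.normalClosure (commRels Γ G)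

/-- The image in the graph product of a syllable, i.e. an element of a vertex group. -/
def ofSyl (s : (v : V) × G v) : GraphProduct Γ G :=
  QuotientGroup.mk (Monoid.CoprodI.of s.2)

/-- The element of the graph product represented by a formal word of syllables. -/
def wordProd (w : List ((v : V) × G v)) : GraphProduct Γ G :=
  (w.map (ofSyl Γ G)).prod

/-- `w` is a formal word of nontrivial syllables representing `g`. -/
def IsWordOf (w : List ((v : V) × G v)) (g : GraphProduct Γ G) : Prop :=
  (∀ s ∈ w, s.2 ≠ 1) ∧ wordProd Γ G w = g

/-- The reduced word length `|g|_r`. -/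
noncomputable def redLength (g : GraphProduct Γ G) : ℕ :=
  sInf {n | ∃ w, IsWordOf Γ G w g ∧ w.length = n}

/-- `w` is a reduced word representing `g` : a representing word of nontrivial syllables
of minimal syllable length. -/
def IsReducedWordOf (w : List ((v : V) × G v)) (g : GraphProduct Γ G) : Prop :=
  IsWordOf Γ G w g ∧ ∀ w', IsWordOf Γ G w' g → w.length ≤ w'.length

/-- `κ`: the maximal number of mutually adjacent vertices of `Γ`. -/
noncomputable def kappa : ℕ :=
  sSup {n | ∃ s : Finset V, Γ.IsNClique n s}

/-- The `d`-tail of `g`: syllables appearing among the last `d` syllables of some reduced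
word representing `g`. -/
def dTail (g : GraphProduct Γ G) (d : ℕ) : Set ((v : V) × G v) :=
  {s | ∃ w, IsReducedWordOf Γ G w g ∧ s ∈ w.drop (w.length - d)}

/-- `g` begins with `G_v`. -/
def BeginsWith (g : GraphProduct Γ G) (v : V) : Prop :=
  ∃ w s, IsReducedWordOf Γ G w g ∧ w.head? = some s ∧ s.1 = v

/-- `g` ends with `G(lk(v))`: some reduced word for `g` has last syllable in a vertex
group adjacent to `v`. -/
def EndsWithLink (g : GraphProduct Γ G) (v : V) : Prop :=
  ∃ w s, IsReducedWordOf Γ G w g ∧ w.getLast? = some s ∧ Γ.Adj s.1 v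

/-- The half-space `𝔸_v` of elements beginning with `G_v`. -/
noncomputable def halfSpace (v : V) : Set (GraphProduct Γ G) :=
  {g | ∃ gv : G v, redLength Γ G (ofSyl Γ G ⟨v, gv⟩ * g) < redLength Γ G g}

/-- Left translate `k • s` of a subset of the graph product. -/
def wallTrans (k : GraphProduct Γ G) (s : Set (GraphProduct Γ G)) : Set (GraphProduct Γ G) :=
  (fun x => k * x) '' s

/-- Two walls (given by their preferred half-spaces) cross if all four intersections of
half-spaces are nonempty. -/
def Cross {X : Type} (s t : Set X) : Prop :=
  (s ∩ t).Nonempty ∧ (s ∩ tᶜ).Nonempty ∧ (sᶜ ∩ t).Nonempty ∧ (sᶜ ∩ tᶜ).Nonempty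

/-- The set of walls `𝕎 = {k𝔸_v}`. -/
noncomputable def Walls : Set (Set (GraphProduct Γ G)) :=
  {s | ∃ (k : GraphProduct Γ G) (v : V), s = wallTrans Γ G k (halfSpace Γ G v)}

/-- The wall (pseudo)distance: the number of walls separating `x` and `y`. -/
noncomputable def wallDist (x y : GraphProduct Γ G) : ℕ :=
  {s | s ∈ Walls Γ G ∧ Xor' (x ∈ s) (y ∈ s)}.ncard

end GraphProd


/-- The image in the free product `A ∗ B` of a syllable. -/
def sylEmb (A B : Type) [Group A] [Group B] : A ⊕ B → Monoid.Coprod A B :=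
  Sum.elim (fun a => Monoid.Coprod.inl a) (fun b => Monoid.Coprod.inr b)


namespace GPAux

set_option linter.unusedSectionVars false
set_option autoImplicit false

open Classical

section

variable {V : Type} (Γ : SimpleGraph V) {G : V → Type} [∀ v, Group (G v)]

noncomputable def coef (v : V) : List ((v : V) × G v) → G v
  | [] => 1
  | s :: t => if h : s.1 = v then h ▸ s.2 else if Γ.Adj s.1 v then coef v t else 1

noncomputable def del (v : V) : List ((v : V) × G v) → List ((v : V) × G v)
  | [] => []
  | s :: t => if s.1 = v then t else if Γ.Adj s.1 v then s :: del v t else s :: t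

noncomputable def put (v : V) (c : G v) (w : List ((v : V) × G v)) : List ((v : V) × G v) :=
  if c = 1 then w else ⟨v, c⟩ :: w

noncomputable def ins (v : V) (a : G v) (w : List ((v : V) × G v)) : List ((v : V) × G v) :=
  put v (a * coef Γ v w) (del Γ v w)

def Red : List ((v : V) × G v) → Prop
  | [] => True
  | s :: t => s.2 ≠ 1 ∧ coef Γ s.1 t = 1 ∧ Red t

inductive Step : List ((v : V) × G v) → List ((v : V) × G v) → Prop
  | swap (s t q) (h : Γ.Adj s.1 t.1) : Step (s :: t :: q) (t :: s :: q)
  | cons (s) {q q'} (h : Step q q') : Step (s :: q) (s :: q')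

def Eqv (w w' : List ((v : V) × G v)) : Prop := Relation.EqvGen (Step Γ) w w'

variable {Γ}

theorem coef_cons_self (v : V) (a : G v) (t) : coef Γ v (⟨v, a⟩ :: t) = a := by simp [coef]
theorem coef_cons_adj {v : V} {s : (v : V) × G v} (h : Γ.Adj s.1 v) (t) :
    coef Γ v (s :: t) = coef Γ v t := by simp [coef, h, h.ne]
theorem coef_cons_non {v : V} {s : (v : V) × G v} (h : ¬ Γ.Adj s.1 v) (h' : s.1 ≠ v) (t) :
    coef Γ v (s :: t) = 1 := by simp [coef, h, h']
theorem del_cons_self (v : V) (a : G v) (t) : del Γ v (⟨v, a⟩ :: t) = t := by simp [del]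
theorem del_cons_adj {v : V} {s : (v : V) × G v} (h : Γ.Adj s.1 v) (t) :
    del Γ v (s :: t) = s :: del Γ v t := by simp [del, h, h.ne]
theorem del_cons_non {v : V} {s : (v : V) × G v} (h : ¬ Γ.Adj s.1 v) (h' : s.1 ≠ v) (t) :
    del Γ v (s :: t) = s :: t := by simp [del, h, h']

theorem Eqv.refl (w : List ((v : V) × G v)) : Eqv Γ w w := Relation.EqvGen.refl _
theorem Eqv.trans {w w' w'' : List ((v : V) × G v)} (h : Eqv Γ w w') (h' : Eqv Γ w' w'') :
    Eqv Γ w w'' := Relation.EqvGen.trans _ _ _ h h'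
theorem Eqv.symm {w w' : List ((v : V) × G v)} (h : Eqv Γ w w') : Eqv Γ w' w :=
  Relation.EqvGen.symm _ _ h
theorem Eqv.cons (s : (v : V) × G v) {w w'} (h : Eqv Γ w w') : Eqv Γ (s :: w) (s :: w') := by
  induction h with
  | rel x y h => exact .rel _ _ (.cons s h)
  | refl x => exact .refl _
  | symm x y _ ih => exact ih.symm
  | trans x y z _ _ h1 h2 => exact h1.trans h2
theorem Eqv.swap (s t : (v : V) × G v) (q) (h : Γ.Adj s.1 t.1) :
    Eqv Γ (s :: t :: q) (t :: s :: q) := .rel _ _ (.swap s t q h)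

theorem Eqv.put (v : V) (c : G v) {w w'} (h : Eqv Γ w w') : Eqv Γ (put v c w) (put v c w') := by
  unfold GPAux.put
  split_ifs
  · exact h
  · exact h.cons _

theorem Eqv.length {w w' : List ((v : V) × G v)} (h : Eqv Γ w w') : w.length = w'.length := by
  induction h with
  | rel x y h => induction h with
    | swap => simp
    | cons s h ih => simp [ih]
  | refl x => rfl
  | symm x y _ ih => exact ih.symm
  | trans x y z _ _ h1 h2 => exact h1.trans h2

theorem Step.coef (v : V) {w w' : List ((v : V) × G v)} (h : Step Γ w w') :
    coef Γ v w = coef Γ v w' := by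
  induction h with
  | swap s t q h =>
    have := h.symm
    obtain ⟨a, x⟩ := s
    obtain ⟨b, y⟩ := t
    dsimp only at *
    by_cases h1 : a = v
    · subst h1
      rw [coef_cons_self, coef_cons_adj (by exact this), coef_cons_self]
    · by_cases h2 : b = v
      · subst h2
        rw [coef_cons_self, coef_cons_adj (by exact h), coef_cons_self]
      · simp only [GPAux.coef, h1, h2, dite_false]
        split_ifs <;> rfl
  | cons s h ih =>
    simp only [GPAux.coef, ih]

theorem Step.del (v : V) {w w' : List ((v : V) × G v)} (h : Step Γ w w') :
    Eqv Γ (del Γ v w) (del Γ v w') := by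
  induction h with
  | swap s t q h =>
    have := h.symm
    obtain ⟨a, x⟩ := s
    obtain ⟨b, y⟩ := t
    dsimp only at *
    by_cases h1 : a = v
    · subst h1
      rw [del_cons_self, del_cons_adj (by exact this), del_cons_self]
      exact .refl _
    · by_cases h2 : b = v
      · subst h2
        rw [del_cons_self, del_cons_adj (by exact h), del_cons_self]
        exact .refl _
      · simp only [GPAux.del, h1, h2, if_false]
        split_ifs <;> exact .swap _ _ _ h
  | cons s h ih =>
    simp only [GPAux.del]
    split_ifs
    · exact .rel _ _ h
    · exact ih.cons _
    · exact .cons _ (.rel _ _ h)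

theorem Eqv.ins (v : V) (a : G v) {w w' : List ((v : V) × G v)} (h : Eqv Γ w w') :
    Eqv Γ (ins Γ v a w) (ins Γ v a w') := by
  induction h with
  | rel x y h =>
    unfold GPAux.ins
    rw [h.coef v]
    exact (h.del v).put _ _
  | refl x => exact .refl _
  | symm x y _ ih => exact ih.symm
  | trans x y z _ _ h1 h2 => exact h1.trans h2

theorem Red.nontriv {w : List ((v : V) × G v)} (h : Red Γ w) : ∀ s ∈ w, s.2 ≠ 1 := by
  induction w with
  | nil => simp
  | cons s t ih =>
    intro x hx
    rcases List.mem_cons.1 hx with rfl | hx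
    · exact h.1
    · exact ih h.2.2 x hx

theorem del_eq {v : V} {w : List ((v : V) × G v)} (hw : ∀ s ∈ w, s.2 ≠ 1) (h : coef Γ v w = 1) :
    del Γ v w = w := by
  induction w with
  | nil => rfl
  | cons s t ih =>
    obtain ⟨a, x⟩ := s
    by_cases h1 : a = v
    · subst h1
      rw [coef_cons_self] at h
      exact absurd h (hw ⟨a, x⟩ (by simp))
    · by_cases h2 : Γ.Adj a v
      · rw [coef_cons_adj (by exact h2)] at h
        rw [del_cons_adj (by exact h2), ih (fun s hs => hw s (by simp [hs])) h]
      · exact del_cons_non h2 h1 _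

theorem eqv_put {v : V} {w : List ((v : V) × G v)} (hw : ∀ s ∈ w, s.2 ≠ 1) :
    Eqv Γ w (put v (coef Γ v w) (del Γ v w)) := by
  induction w with
  | nil => simp [coef, del, put]; exact .refl _
  | cons s t ih =>
    obtain ⟨a, x⟩ := s
    have hx := hw ⟨a, x⟩ (by simp)
    by_cases h1 : a = v
    · subst h1
      rw [coef_cons_self, del_cons_self, put, if_neg hx]
      exact .refl _
    · by_cases h2 : Γ.Adj a v
      · rw [coef_cons_adj (by exact h2), del_cons_adj (by exact h2)]
        refine ((ih (fun s hs => hw s (by simp [hs]))).cons _).trans ?_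
        unfold put
        split_ifs
        · exact .refl _
        · exact .swap _ _ _ h2
      · rw [coef_cons_non h2 h1, del_cons_non h2 h1, put, if_pos rfl]
        exact .refl _

theorem coef_del_adj {u v : V} (huv : Γ.Adj u v) (w : List ((v : V) × G v)) :
    coef Γ u (del Γ v w) = coef Γ u w := by
  induction w with
  | nil => rfl
  | cons s t ih =>
    obtain ⟨a, x⟩ := s
    by_cases h1 : a = v
    · subst h1
      rw [del_cons_self, coef_cons_adj (by exact huv.symm)]
    · by_cases h2 : Γ.Adj a v
      · rw [del_cons_adj (by exact h2)]
        simp only [coef, ih]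
      · rw [del_cons_non h2 h1]

theorem del_del_adj {u v : V} (huv : Γ.Adj u v) (w : List ((v : V) × G v)) :
    del Γ u (del Γ v w) = del Γ v (del Γ u w) := by
  induction w with
  | nil => rfl
  | cons s t ih =>
    obtain ⟨a, x⟩ := s
    by_cases h1 : a = v
    · subst h1
      rw [del_cons_self, del_cons_adj (by exact huv.symm), del_cons_self]
    · by_cases h3 : a = u
      · subst h3
        rw [del_cons_self, del_cons_adj (by exact huv), del_cons_self]
      · by_cases h2 : Γ.Adj a v <;> by_cases h4 : Γ.Adj a u <;> simp [del, h1, h2, h3, h4, ih]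

theorem coef_put_adj {u v : V} (huv : Γ.Adj u v) (c : G v) (w : List ((v : V) × G v)) :
    coef Γ u (put v c w) = coef Γ u w := by
  unfold put
  split_ifs
  · rfl
  · exact coef_cons_adj (by exact huv.symm) _

theorem del_put_adj {u v : V} (huv : Γ.Adj u v) (c : G v) (w : List ((v : V) × G v)) :
    del Γ u (put v c w) = put v c (del Γ u w) := by
  unfold put
  split_ifs
  · rfl
  · exact del_cons_adj (by exact huv.symm) _

theorem put_put_adj {u v : V} (huv : Γ.Adj u v) (c : G u) (d : G v) (w : List ((v : V) × G v)) :
    Eqv Γ (put u c (put v d w)) (put v d (put u c w)) := by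
  unfold put
  split_ifs
  · exact .refl _
  · exact .refl _
  · exact .refl _
  · exact .swap _ _ _ huv

theorem ins_comm {u v : V} (huv : Γ.Adj u v) (a : G u) (b : G v) (w : List ((v : V) × G v)) :
    Eqv Γ (ins Γ u a (ins Γ v b w)) (ins Γ v b (ins Γ u a w)) := by
  unfold ins
  rw [coef_put_adj huv, del_put_adj huv, coef_put_adj huv.symm, del_put_adj huv.symm,
    coef_del_adj huv, coef_del_adj huv.symm, del_del_adj huv]
  exact put_put_adj huv _ _ _

theorem coef_del_self {v : V} {w : List ((v : V) × G v)} (hw : Red Γ w) :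
    coef Γ v (del Γ v w) = 1 := by
  induction w with
  | nil => rfl
  | cons s t ih =>
    obtain ⟨a, x⟩ := s
    by_cases h1 : a = v
    · subst h1
      rw [del_cons_self]
      exact hw.2.1
    · by_cases h2 : Γ.Adj a v
      · rw [del_cons_adj (by exact h2), coef_cons_adj (by exact h2), ih hw.2.2]
      · rw [del_cons_non h2 h1, coef_cons_non h2 h1]

theorem Red.del (v : V) {w : List ((v : V) × G v)} (hw : Red Γ w) : Red Γ (del Γ v w) := by
  induction w with
  | nil => trivial
  | cons s t ih =>
    obtain ⟨a, x⟩ := s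
    by_cases h1 : a = v
    · subst h1
      rw [del_cons_self]
      exact hw.2.2
    · by_cases h2 : Γ.Adj a v
      · rw [del_cons_adj (by exact h2)]
        exact ⟨hw.1, by rw [coef_del_adj h2]; exact hw.2.1, ih hw.2.2⟩
      · rw [del_cons_non h2 h1]
        exact hw

theorem Red.put {v : V} (c : G v) {w : List ((v : V) × G v)} (hw : Red Γ w)
    (h : coef Γ v w = 1) : Red Γ (put v c w) := by
  unfold GPAux.put
  split_ifs with hc
  · exact hw
  · exact ⟨hc, h, hw⟩

theorem Red.ins (v : V) (a : G v) {w : List ((v : V) × G v)} (hw : Red Γ w) :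
    Red Γ (ins Γ v a w) := (hw.del v).put _ (coef_del_self hw)

theorem ins_ins (v : V) (a b : G v) {w : List ((v : V) × G v)} (hw : Red Γ w) :
    ins Γ v a (ins Γ v b w) = ins Γ v (a * b) w := by
  have h1 := coef_del_self (v := v) hw
  have h2 := del_eq (hw.del v).nontriv h1
  have h3 : ∀ c : G v, coef Γ v (put v c (del Γ v w)) = c := by
    intro c
    unfold put
    split_ifs with hc
    · rw [h1, hc]
    · exact coef_cons_self _ _ _
  have h4 : ∀ c : G v, del Γ v (put v c (del Γ v w)) = del Γ v w := by
    intro c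
    unfold put
    split_ifs with hc
    · exact h2
    · exact del_cons_self _ _ _
  unfold ins
  rw [h3, h4, mul_assoc]

theorem length_del (v : V) (w : List ((v : V) × G v)) :
    (del Γ v w).length ≤ w.length := by
  induction w with
  | nil => simp [del]
  | cons s t ih =>
    simp only [del]
    split_ifs <;> simp [ih]

theorem length_del_lt {v : V} {w : List ((v : V) × G v)} (h : coef Γ v w ≠ 1) :
    (del Γ v w).length < w.length := by
  induction w with
  | nil => exact absurd rfl h
  | cons s t ih =>
    obtain ⟨a, x⟩ := s
    by_cases h1 : a = v
    · subst h1
      rw [del_cons_self]; simp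
    · by_cases h2 : Γ.Adj a v
      · rw [coef_cons_adj (by exact h2)] at h
        rw [del_cons_adj (by exact h2)]
        simpa using ih h
      · exact absurd (coef_cons_non h2 h1 _) h

theorem length_put (v : V) (c : G v) (w : List ((v : V) × G v)) :
    (put v c w).length ≤ w.length + 1 := by
  unfold put
  split_ifs <;> simp

theorem ins_red {s : (v : V) × G v} {t : List ((v : V) × G v)} (h : Red Γ (s :: t)) :
    ins Γ s.1 s.2 t = s :: t := by
  unfold ins
  rw [h.2.1, del_eq h.2.2.nontriv h.2.1, mul_one, put, if_neg h.1]

variable (Γ G)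

def X : Type := Quot (fun a b : {w : List ((v : V) × G v) // Red Γ w} => Eqv Γ a.1 b.1)

variable {Γ G}

def X.mk (w : List ((v : V) × G v)) (h : Red Γ w) : X Γ G := Quot.mk _ ⟨w, h⟩

theorem X.sound {w w' : List ((v : V) × G v)} (h : Red Γ w) (h' : Red Γ w') (e : Eqv Γ w w') :
    X.mk w h = X.mk w' h' := Quot.sound e

def X.len (x : X Γ G) : ℕ := Quot.lift (fun a => a.1.length) (fun _ _ h => Eqv.length h) x

noncomputable def X.ins (v : V) (a : G v) (x : X Γ G) : X Γ G :=
  Quot.lift (fun w => X.mk (GPAux.ins Γ v a w.1) (w.2.ins v a))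
    (fun _ _ h => X.sound _ _ (h.ins v a)) x

theorem X.ins_mk (v : V) (a : G v) (w : List ((v : V) × G v)) (h : Red Γ w) :
    X.ins v a (X.mk w h) = X.mk (GPAux.ins Γ v a w) (h.ins v a) := rfl

theorem X.ind {p : X Γ G → Prop} (h : ∀ w hw, p (X.mk w hw)) (x : X Γ G) : p x :=
  Quot.ind (fun a => h a.1 a.2) x

theorem X.len_ins (v : V) (a : G v) (x : X Γ G) : (X.ins v a x).len ≤ x.len + 1 := by
  induction x using X.ind with
  | h w hw =>
    show (GPAux.ins Γ v a w).length ≤ w.length + 1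
    exact (length_put _ _ _).trans (by have := length_del (Γ := Γ) v w; omega)

variable (Γ G)

noncomputable def actV (v : V) : G v →* Function.End (X Γ G) where
  toFun a := X.ins v a
  map_one' := by
    funext x
    induction x using X.ind with
    | h w hw =>
      rw [X.ins_mk]
      refine X.sound _ _ ?_
      unfold ins
      rw [one_mul]
      exact (eqv_put hw.nontriv).symm
  map_mul' a b := by
    funext x
    induction x using X.ind with
    | h w hw =>
      have e : X.ins v (a * b) (X.mk w hw) = X.ins v a (X.ins v b (X.mk w hw)) := by
        rw [X.ins_mk, X.ins_mk, X.ins_mk]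
        congr 1
        exact (ins_ins v a b hw).symm
      exact e

noncomputable def act0 : Monoid.CoprodI G →* Function.End (X Γ G) :=
  Monoid.CoprodI.lift (actV Γ G)

theorem act0_comm {u v : V} (huv : Γ.Adj u v) (a : G u) (b : G v) :
    actV Γ G u a * actV Γ G v b = actV Γ G v b * actV Γ G u a := by
  funext x
  induction x using X.ind with
  | h w hw => exact X.sound _ _ (ins_comm huv a b w)

theorem act0_ker : Subgroup.normalClosure (commRels Γ G) ≤ (act0 Γ G).ker := by
  refine Subgroup.normalClosure_le_normal ?_
  rintro x ⟨v, w, a, b, h, rfl⟩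
  show act0 Γ G _ = 1
  have e : ⁅(Monoid.CoprodI.of a : Monoid.CoprodI G), Monoid.CoprodI.of b⁆ =
    Monoid.CoprodI.of a * Monoid.CoprodI.of b * (Monoid.CoprodI.of a⁻¹ * Monoid.CoprodI.of b⁻¹) := by
    rw [commutatorElement_def, map_inv, map_inv, mul_assoc]
  rw [e, map_mul, map_mul, map_mul]
  simp only [act0, Monoid.CoprodI.lift_of]
  rw [act0_comm Γ G h, mul_assoc, ← mul_assoc (actV Γ G v a), ← map_mul, mul_inv_cancel, map_one,
    one_mul, ← map_mul, mul_inv_cancel, map_one]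

noncomputable def act : GraphProduct Γ G →* Function.End (X Γ G) :=
  QuotientGroup.lift _ (act0 Γ G) (act0_ker Γ G)

theorem act_ofSyl (s : (v : V) × G v) (x : X Γ G) : act Γ G (ofSyl Γ G s) x = X.ins s.1 s.2 x := by
  have : act Γ G (ofSyl Γ G s) = act0 Γ G (Monoid.CoprodI.of s.2) := rfl
  rw [this, act0, Monoid.CoprodI.lift_of]
  rfl

theorem wordProd_cons (s : (v : V) × G v) (t) :
    wordProd Γ G (s :: t) = ofSyl Γ G s * wordProd Γ G t := by simp [wordProd]

theorem wordProd_append (s t : List ((v : V) × G v)) :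
    wordProd Γ G (s ++ t) = wordProd Γ G s * wordProd Γ G t := by simp [wordProd]

theorem act_cons (s : (v : V) × G v) (t) (x : X Γ G) :
    act Γ G (wordProd Γ G (s :: t)) x = X.ins s.1 s.2 (act Γ G (wordProd Γ G t) x) := by
  rw [wordProd_cons, map_mul]
  exact act_ofSyl Γ G _ _

def X.nil : X Γ G := X.mk [] trivial

theorem len_act_le (w : List ((v : V) × G v)) :
    (act Γ G (wordProd Γ G w) (X.nil Γ G)).len ≤ w.length := by
  induction w with
  | nil => simp [wordProd]; rfl
  | cons s t ih =>
    rw [act_cons]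
    exact (X.len_ins _ _ _).trans (by simpa using ih)

theorem act_red (w : List ((v : V) × G v)) (h : Red Γ w) :
    act Γ G (wordProd Γ G w) (X.nil Γ G) = X.mk w h := by
  induction w with
  | nil => simp [wordProd]; rfl
  | cons s t ih =>
    rw [act_cons, ih h.2.2, X.ins_mk]
    congr 1
    exact ins_red h

theorem red_min {w : List ((v : V) × G v)} (h : Red Γ w) :
    IsReducedWordOf Γ G w (wordProd Γ G w) := by
  refine ⟨⟨h.nontriv, rfl⟩, fun w' hw' => ?_⟩
  have := len_act_le Γ G w'
  rw [hw'.2, act_red Γ G w h] at this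
  exact this

theorem ofSyl_one (v : V) : ofSyl Γ G ⟨v, 1⟩ = 1 := by simp [ofSyl]
theorem ofSyl_mul (v : V) (a b : G v) :
    ofSyl Γ G ⟨v, a * b⟩ = ofSyl Γ G ⟨v, a⟩ * ofSyl Γ G ⟨v, b⟩ := by simp [ofSyl]
theorem ofSyl_inv (s : (v : V) × G v) : ofSyl Γ G ⟨s.1, s.2⁻¹⟩ = (ofSyl Γ G s)⁻¹ := by
  simp [ofSyl]
theorem ofSyl_comm (s t : (v : V) × G v) (h : Γ.Adj s.1 t.1) :
    ofSyl Γ G s * ofSyl Γ G t = ofSyl Γ G t * ofSyl Γ G s := by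
  rw [← mul_inv_eq_one, mul_inv_rev, ← mul_assoc]
  have : (Monoid.CoprodI.of s.2 * Monoid.CoprodI.of t.2 * (Monoid.CoprodI.of s.2)⁻¹ *
      (Monoid.CoprodI.of t.2)⁻¹ : Monoid.CoprodI G) ∈ Subgroup.normalClosure (commRels Γ G) :=
    Subgroup.subset_normalClosure ⟨s.1, t.1, s.2, t.2, h, by rw [commutatorElement_def]⟩
  exact (QuotientGroup.eq_one_iff _).2 this

theorem wordProd_put (v : V) (c : G v) (w : List ((v : V) × G v)) :
    wordProd Γ G (put v c w) = ofSyl Γ G ⟨v, c⟩ * wordProd Γ G w := by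
  unfold put
  split_ifs with h
  · rw [h, ofSyl_one, one_mul]
  · exact wordProd_cons _ _ _ _

theorem wordProd_del (v : V) (w : List ((v : V) × G v)) :
    ofSyl Γ G ⟨v, coef Γ v w⟩ * wordProd Γ G (del Γ v w) = wordProd Γ G w := by
  induction w with
  | nil => simp [coef, del, ofSyl_one]
  | cons s t ih =>
    obtain ⟨a, x⟩ := s
    by_cases h1 : a = v
    · subst h1
      rw [coef_cons_self, del_cons_self, wordProd_cons]
    · by_cases h2 : Γ.Adj a v
      · rw [coef_cons_adj (by exact h2), del_cons_adj (by exact h2), wordProd_cons, wordProd_cons,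
          ← mul_assoc, ofSyl_comm Γ G _ _ (by exact h2.symm), mul_assoc, ih]
      · rw [coef_cons_non h2 h1, del_cons_non h2 h1, ofSyl_one, one_mul]

variable {Γ G}

theorem nontriv_del {v : V} {w : List ((v : V) × G v)} (hw : ∀ s ∈ w, s.2 ≠ 1) :
    ∀ s ∈ del Γ v w, s.2 ≠ 1 := by
  induction w with
  | nil => exact hw
  | cons s t ih =>
    have := ih (fun s hs => hw s (by simp [hs]))
    have h1 := hw s (by simp)
    simp only [del]
    split_ifs
    · exact fun s hs => hw s (by simp [hs])
    · intro x hx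
      rcases List.mem_cons.1 hx with rfl | hx
      · exact h1
      · exact this x hx
    · exact hw

theorem nontriv_put {v : V} {c : G v} {w : List ((v : V) × G v)} (hw : ∀ s ∈ w, s.2 ≠ 1) :
    ∀ s ∈ put v c w, s.2 ≠ 1 := by
  unfold put
  split_ifs with hc
  · exact hw
  · intro x hx
    rcases List.mem_cons.1 hx with rfl | hx
    · exact hc
    · exact hw x hx

theorem min_red {w : List ((v : V) × G v)} {g : GraphProduct Γ G} (h : IsReducedWordOf Γ G w g) :
    Red Γ w := by
  induction w generalizing g with
  | nil => trivial
  | cons s t ih =>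
    obtain ⟨⟨h1, h2⟩, h3⟩ := h
    have ht : ∀ s ∈ t, s.2 ≠ 1 := fun s hs => h1 s (by simp [hs])
    have hs := h1 s (by simp)
    refine ⟨hs, ?_, ih (g := wordProd Γ G t) ⟨⟨ht, rfl⟩, ?_⟩⟩
    · by_contra hc
      have := h3 (put s.1 (s.2 * coef Γ s.1 t) (del Γ s.1 t)) ⟨nontriv_put (nontriv_del ht), by
        rw [wordProd_put, ofSyl_mul, mul_assoc, wordProd_del, ← h2, wordProd_cons]⟩
      have h4 := length_put s.1 (s.2 * coef Γ s.1 t) (del Γ s.1 t)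
      have h5 := length_del_lt hc
      simp only [List.length_cons] at this
      omega
    · intro w' hw'
      have := h3 (s :: w') ⟨by
        intro x hx
        rcases List.mem_cons.1 hx with rfl | hx
        · exact hs
        · exact hw'.1 x hx, by rw [wordProd_cons, hw'.2, ← h2, wordProd_cons]⟩
      simpa using this

def inv (w : List ((v : V) × G v)) : List ((v : V) × G v) :=
  (w.map (fun s => (⟨s.1, s.2⁻¹⟩ : (v : V) × G v))).reverse

theorem wordProd_inv (w : List ((v : V) × G v)) :
    wordProd Γ G (inv w) = (wordProd Γ G w)⁻¹ := by
  induction w with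
  | nil => simp [inv, wordProd]
  | cons s t ih =>
    have : inv (s :: t) = inv t ++ [⟨s.1, s.2⁻¹⟩] := by simp [inv]
    rw [this, wordProd_append, ih, wordProd_cons, wordProd_cons, mul_inv_rev, ← ofSyl_inv]
    simp [wordProd]

theorem isWordOf_inv {w : List ((v : V) × G v)} {g : GraphProduct Γ G} (h : IsWordOf Γ G w g) :
    IsWordOf Γ G (inv w) g⁻¹ := by
  refine ⟨?_, by rw [wordProd_inv, h.2]⟩
  intro s hs
  simp only [inv, List.mem_reverse, List.mem_map] at hs
  obtain ⟨a, ha, rfl⟩ := hs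
  simpa using h.1 a ha

theorem isRed_inv {w : List ((v : V) × G v)} {g : GraphProduct Γ G}
    (h : IsReducedWordOf Γ G w g) : IsReducedWordOf Γ G (inv w) g⁻¹ := by
  refine ⟨isWordOf_inv h.1, fun w' hw' => ?_⟩
  have h1 := isWordOf_inv hw'
  rw [inv_inv] at h1
  have := h.2 _ h1
  simpa [inv] using this

theorem exists_red (g : GraphProduct Γ G) : ∃ w, IsReducedWordOf Γ G w g := by
  have key : ∃ w, IsWordOf Γ G w g := by
    obtain ⟨x, rfl⟩ := QuotientGroup.mk_surjective g
    induction x using Monoid.CoprodI.induction_left with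
    | one => exact ⟨[], by simp, by simp [wordProd]⟩
    | mul m x ih =>
      obtain ⟨w, hw⟩ := ih
      rename_i i
      refine ⟨put i m w, nontriv_put hw.1, ?_⟩
      rw [wordProd_put, hw.2]
      rfl
  let P : ℕ → Prop := fun n => ∃ w, IsWordOf Γ G w g ∧ w.length = n
  have hP : ∃ n, P n := by
    obtain ⟨w, hw⟩ := key
    exact ⟨_, w, hw, rfl⟩
  obtain ⟨w, hw, hl⟩ := Nat.find_spec hP
  exact ⟨w, hw, fun w' hw' => by rw [hl]; exact Nat.find_min' hP ⟨w', hw', rfl⟩⟩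

theorem coef_append {u : V} {q : List ((v : V) × G v)} (hq : ∀ s ∈ q, s.2 ≠ 1)
    (h : coef Γ u q = 1) (r : List ((v : V) × G v)) :
    coef Γ u (q ++ r) = 1 ∨ ((∀ x ∈ q, Γ.Adj x.1 u) ∧ coef Γ u (q ++ r) = coef Γ u r) := by
  induction q with
  | nil => right; simp
  | cons s t ih =>
    obtain ⟨a, x⟩ := s
    by_cases h1 : a = u
    · subst h1
      rw [coef_cons_self] at h
      exact absurd h (hq ⟨a, x⟩ (by simp))
    · by_cases h2 : Γ.Adj a u
      · rw [coef_cons_adj (by exact h2)] at h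
        rw [List.cons_append, coef_cons_adj (by exact h2)]
        rcases ih (fun s hs => hq s (by simp [hs])) h with h | ⟨h3, h4⟩
        · exact .inl h
        · exact .inr ⟨by
            intro y hy
            rcases List.mem_cons.1 hy with rfl | hy
            · exact h2
            · exact h3 y hy, h4⟩
      · left
        exact coef_cons_non h2 h1 _

theorem red_append {w r : List ((v : V) × G v)} (hw : Red Γ w) (hr : Red Γ r)
    (h : ∀ p s q, w = p ++ s :: q → (∀ x ∈ q, Γ.Adj x.1 s.1) → coef Γ s.1 r = 1) :
    Red Γ (w ++ r) := by
  induction w with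
  | nil => exact hr
  | cons s t ih =>
    refine ⟨hw.1, ?_, ih hw.2.2 ?_⟩
    · rcases coef_append hw.2.2.nontriv hw.2.1 r with h1 | ⟨h1, h2⟩
      · exact h1
      · exact h2.trans (h [] s t rfl h1)
    · intro p s' q e
      exact h (s :: p) s' q (by simp [e])

theorem wordProd_comm (s : (v : V) × G v) (q : List ((v : V) × G v))
    (h : ∀ x ∈ q, Γ.Adj x.1 s.1) :
    wordProd Γ G (q ++ [s]) = wordProd Γ G (s :: q) := by
  induction q with
  | nil => rfl
  | cons a t ih =>
    rw [List.cons_append, wordProd_cons, ih (fun x hx => h x (by simp [hx])), wordProd_cons,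
      wordProd_cons, wordProd_cons, ← mul_assoc, ofSyl_comm Γ G _ _ (h a (by simp)), mul_assoc]

theorem shuffle_last {p q : List ((v : V) × G v)} {s : (v : V) × G v} {g : GraphProduct Γ G}
    (hw : IsReducedWordOf Γ G (p ++ s :: q) g) (h : ∀ x ∈ q, Γ.Adj x.1 s.1) :
    IsReducedWordOf Γ G (p ++ (q ++ [s])) g := by
  refine ⟨⟨?_, ?_⟩, ?_⟩
  · intro x hx
    refine hw.1.1 x ?_
    simp only [List.mem_append, List.mem_cons, List.not_mem_nil] at hx ⊢
    tauto
  · rw [wordProd_append, wordProd_comm s q h, ← wordProd_append, hw.1.2]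
  · intro w' hw'
    have := hw.2 w' hw'
    simpa using this

theorem begins_of_coef {v : V} {r : List ((v : V) × G v)} {g : GraphProduct Γ G}
    (hr : IsReducedWordOf Γ G r g) (h : coef Γ v r ≠ 1) : BeginsWith Γ G g v := by
  have h1 := length_del_lt h
  refine ⟨⟨v, coef Γ v r⟩ :: del Γ v r, _, ⟨⟨?_, ?_⟩, fun w' hw' => ?_⟩, rfl, rfl⟩
  · intro x hx
    rcases List.mem_cons.1 hx with rfl | hx
    · exact h
    · exact nontriv_del hr.1.1 x hx
  · rw [wordProd_cons, wordProd_del, hr.1.2]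
  · have := hr.2 w' hw'
    simp only [List.length_cons]
    omega

end

end GPAux

section Statements

variable {V : Type} [Fintype V] (Γ : SimpleGraph V) (G : V → Type) [∀ v, Group (G v)]

theorem stmt3 (g h : GraphProduct Γ G) (v : V) (hend : ¬ EndsWithLink Γ G h v) :
    ((BeginsWith Γ G h⁻¹ v ∧ ¬ BeginsWith Γ G (h⁻¹ * g) v) →
      ∃ (wg : List ((v : V) × G v)) (m : ℕ), 0 < m ∧ m ≤ wg.length ∧
        IsReducedWordOf Γ G wg g ∧ IsReducedWordOf Γ G (wg.take m) h ∧
        ∃ s : (v : V) × G v, wg[m - 1]? = some s ∧ s.1 = v) ∧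
    ((BeginsWith Γ G (h⁻¹ * g) v ∧ ¬ BeginsWith Γ G h⁻¹ v) →
      ∃ (wg : List ((v : V) × G v)) (m : ℕ), m < wg.length ∧
        IsReducedWordOf Γ G wg g ∧ IsReducedWordOf Γ G (wg.take m) h ∧
        ∃ s : (v : V) × G v, wg[m]? = some s ∧ s.1 = v) := by
  constructor
  · rintro ⟨⟨w', s, hw', hs, hsv⟩, hnb⟩
    obtain ⟨r, hr⟩ := GPAux.exists_red (h⁻¹ * g)
    obtain ⟨t, rfl⟩ : ∃ t, w' = s :: t := by
      cases w' with
      | nil => simp at hs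
      | cons a t => simp at hs; exact ⟨t, by rw [hs]⟩
    have hw := GPAux.isRed_inv hw'
    rw [inv_inv] at hw
    have e : GPAux.inv (s :: t) = GPAux.inv t ++ [⟨s.1, s.2⁻¹⟩] := by simp [GPAux.inv]
    rw [e] at hw
    subst hsv
    set a : (v : V) × G v := ⟨s.1, s.2⁻¹⟩ with ha
    set w := GPAux.inv t with hwd
    have hcoef : GPAux.coef Γ s.1 r = 1 := by
      by_contra hc
      exact hnb (GPAux.begins_of_coef hr hc)
    have hred : GPAux.Red Γ ((w ++ [a]) ++ r) := by
      refine GPAux.red_append (GPAux.min_red hw) (GPAux.min_red hr) ?_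
      intro p b q hpq hadj
      rcases List.eq_nil_or_concat q with rfl | ⟨q', c, rfl⟩
      · have := (List.append_inj' hpq rfl).2
        simp only [List.cons.injEq, and_true] at this
        rw [← this]
        exact hcoef
      · exfalso
        have h2 : w ++ [a] = (p ++ b :: q') ++ [c] := by rw [hpq]; simp
        have := (List.append_inj' h2 rfl).2
        simp only [List.cons.injEq, and_true] at this
        have h3 := hadj c (by simp)
        rw [hpq] at hw
        refine hend ⟨_, b, GPAux.shuffle_last hw hadj, by simp, ?_⟩
        rw [← this] at h3
        exact h3.symm
    have hfin := GPAux.red_min Γ G hred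
    rw [GPAux.wordProd_append, hw.1.2, hr.1.2, mul_inv_cancel_left] at hfin
    refine ⟨(w ++ [a]) ++ r, (w ++ [a]).length, by simp, by simp, hfin, ?_, a, ?_, rfl⟩
    · rw [List.take_left]
      exact hw
    · simp
  · rintro ⟨⟨r, s, hr, hs, hsv⟩, hnb⟩
    obtain ⟨w, hw⟩ := GPAux.exists_red h
    obtain ⟨t, rfl⟩ : ∃ t, r = s :: t := by
      cases r with
      | nil => simp at hs
      | cons a t => simp at hs; exact ⟨t, by rw [hs]⟩
    have hred : GPAux.Red Γ (w ++ (s :: t)) := by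
      refine GPAux.red_append (GPAux.min_red hw) (GPAux.min_red hr) ?_
      intro p b q hpq hadj
      by_contra hc
      rw [hpq] at hw
      have hsh := GPAux.shuffle_last hw hadj
      by_cases h1 : s.1 = b.1
      · refine hnb ⟨_, ⟨b.1, b.2⁻¹⟩, GPAux.isRed_inv hsh, by simp [GPAux.inv], by rw [← hsv, h1]⟩
      · by_cases h2 : Γ.Adj s.1 b.1
        · exact hend ⟨_, b, hsh, by simp, hsv ▸ h2.symm⟩
        · exact hc (GPAux.coef_cons_non h2 h1 _)
    have hfin := GPAux.red_min Γ G hred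
    rw [GPAux.wordProd_append, hw.1.2, hr.1.2, mul_inv_cancel_left] at hfin
    refine ⟨w ++ (s :: t), w.length, by simp, hfin, ?_, s, by simp, hsv⟩
    rw [List.take_left]
    exact hw


end Statements
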